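/- Let S be a compact orientable surface and K ⊂ S a compact set contained in some closed annulus E ⊂ S. Given a countable family A of closed annuli in S with the property that every closed annulus E is essentially contained in the interior of some E' ∈ A, there exists E' ∈ A with K ⊂ int E' and K essential in E' whenever K is an essential annular continuum in E. -/

import Mathlib

open Set Topology Filter

noncomputable section

/-- The circle `ℝ/ℤ`. -/
abbrev Circ : Type := AddCircle (1 : ℝ)

/-- The open annulus `S¹ × ℝ`. -/
abbrev Ann : Type := Circ × ℝ

/-- The standard closed annulus `S¹ × [0,1]` inside `Ann`. -/
def stdA : Set Ann := {p | p.2 ∈ Icc (0:ℝ) 1}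

/-- The lower boundary circle of the standard closed annulus. -/
def bdLow : Set Ann := {p | p.2 = 0}

/-- The upper boundary circle of the standard closed annulus. -/
def bdHigh : Set Ann := {p | p.2 = 1}

/-- The half-open model annulus `S¹ × [0,1)`. -/
def halfOpenAnn : Set Ann := {p | p.2 ∈ Ico (0:ℝ) 1}

/-- `W` has exactly two connected components, `Km` and `Kp`. -/
def TwoComponents (W Km Kp : Set Ann) : Prop :=
  Km ≠ Kp ∧ Km ∪ Kp = W ∧
  (∃ x ∈ W, connectedComponentIn W x = Km) ∧
  (∃ x ∈ W, connectedComponentIn W x = Kp) ∧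
  ∀ x ∈ W, connectedComponentIn W x = Km ∨ connectedComponentIn W x = Kp

/-- `K` is an annular continuum in the standard closed annulus, with complementary
pieces `Km` (containing the lower boundary) and `Kp` (containing the upper boundary),
each homeomorphic to a (half-open) annulus. -/
def AnnularContinuum (K Km Kp : Set Ann) : Prop :=
  IsCompact K ∧ IsConnected K ∧ K ⊆ stdA ∧
  TwoComponents (stdA \ K) Km Kp ∧
  bdLow ⊆ Km ∧ bdHigh ⊆ Kp ∧
  Nonempty (↥Km ≃ₜ ↥halfOpenAnn) ∧ Nonempty (↥Kp ≃ₜ ↥halfOpenAnn)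

/-- The boundary in the standard closed annulus of a relatively open subset. -/
def relBd (E : Set Ann) : Set Ann := closure E \ E

/-- `K` is a frontier: an annular continuum which coincides with the boundary of each of
its two complementary pieces. -/
def IsFrontierSet (K : Set Ann) : Prop :=
  ∃ Km Kp, AnnularContinuum K Km Kp ∧ K = relBd Km ∧ K = relBd Kp

/-- `E` is a closed annulus in `S`: the image of the standard closed annulus under an open
embedding of the annulus into `S`. -/
def IsClosedAnnulusIn {S : Type*} [TopologicalSpace S] (E : Set S) : Prop :=
  ∃ e : Ann → S, IsOpenEmbedding e ∧ E = e '' stdA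

/-- `K` is essential in the closed annulus `E`: there is an open embedding `e` of the
standard annulus with `E = e(stdA)` (so that the range of `e` is an open annular
neighborhood of `E`) carrying an annular continuum of the standard closed annulus onto
`K`; in particular `K` separates the two boundary components of `E`. -/
def EssentialIn {S : Type*} [TopologicalSpace S] (K E : Set S) : Prop :=
  ∃ e : Ann → S, IsOpenEmbedding e ∧ E = e '' stdA ∧
    ∃ K₀ Km Kp : Set Ann, AnnularContinuum K₀ Km Kp ∧ K = e '' K₀

/-- No loop winding once around the origin can be contracted in the punctured plane. -/
theorem no_contraction_of_circle (H : C(unitInterval × Circle, {z : ℂ // z ≠ 0}))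
    (s : ℝ) (c : {z : ℂ // z ≠ 0}) (h_zero : ∀ z, H (0, z) = c)
    (h_one : ∀ z : Circle, (H (1, z) : ℂ) = s * z) : False := by
  have cov := Complex.isCoveringMap_exp
  obtain ⟨w, hw⟩ : ∃ w : ℂ, Complex.exp w = c := ⟨Complex.log c, Complex.exp_log c.2⟩
  have hc : ∀ a : Circle, H (0, a) =
      (fun z : ℂ ↦ (⟨_, z.exp_ne_zero⟩ : {z : ℂ // z ≠ 0})) (ContinuousMap.const Circle w a) := by
    intro a
    rw [h_zero]
    exact Subtype.ext hw.symm
  set L := cov.liftHomotopy H (ContinuousMap.const Circle w) hc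
  have hL : ∀ z : Circle, Complex.exp (L (1, z)) = s * z := by
    intro z
    rw [← h_one]
    exact congrArg Subtype.val (congrFun (cov.liftHomotopy_lifts H _ hc) (1, z))
  have h₁ : Continuous fun θ : ℝ ↦ L (1, Circle.exp θ) :=
    L.continuous.comp (continuous_const.prodMk Circle.exp.continuous)
  have h₂ : Continuous fun θ : ℝ ↦ L (1, 1) + θ * Complex.I := by fun_prop
  have heq := cov.eq_of_comp_eq h₁ h₂ (by
    funext θ
    apply Subtype.ext
    simp only [Function.comp]
    rw [hL, Complex.exp_add, hL, Circle.coe_exp]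
    simp) 0 (by simp)
  have := congrFun heq (2 * Real.pi)
  simp [Real.pi_ne_zero] at this

/-- `f` and `g` restrict to mutually inverse homeomorphisms between `X` and `Y`. -/
structure HomeoOn {α β : Type*} [TopologicalSpace α] [TopologicalSpace β]
    (f : α → β) (g : β → α) (X : Set α) (Y : Set β) : Prop where
  contf : ContinuousOn f X
  contg : ContinuousOn g Y
  mapsf : MapsTo f X Y
  mapsg : MapsTo g Y X
  left : ∀ x ∈ X, g (f x) = x
  right : ∀ y ∈ Y, f (g y) = y

namespace HomeoOn

variable {α β γ : Type*} [TopologicalSpace α] [TopologicalSpace β] [TopologicalSpace γ]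
  {f : α → β} {g : β → α} {X : Set α} {Y : Set β}

theorem symm (h : HomeoOn f g X Y) : HomeoOn g f Y X :=
  ⟨h.contg, h.contf, h.mapsg, h.mapsf, h.right, h.left⟩

theorem refl (X : Set α) : HomeoOn id id X X :=
  ⟨continuousOn_id, continuousOn_id, mapsTo_id X, mapsTo_id X, fun _ _ ↦ rfl, fun _ _ ↦ rfl⟩

theorem trans {f' : β → γ} {g' : γ → β} {Z : Set γ} (h : HomeoOn f g X Y)
    (h' : HomeoOn f' g' Y Z) : HomeoOn (f' ∘ f) (g ∘ g') X Z where
  contf := h'.contf.comp h.contf h.mapsf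
  contg := h.contg.comp h'.contg h'.mapsg
  mapsf := h'.mapsf.comp h.mapsf
  mapsg := h.mapsg.comp h'.mapsg
  left x hx := by simp [h'.left _ (h.mapsf hx), h.left x hx]
  right x hx := by simp [h.right _ (h'.mapsg hx), h'.right x hx]

theorem mono (h : HomeoOn f g X Y) {X' : Set α} {Y' : Set β} (hX : X' ⊆ X) (hY : Y' ⊆ Y)
    (hf : MapsTo f X' Y') (hg : MapsTo g Y' X') : HomeoOn f g X' Y' :=
  ⟨h.contf.mono hX, h.contg.mono hY, hf, hg, fun x hx ↦ h.left x (hX hx),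
    fun y hy ↦ h.right y (hY hy)⟩

theorem image (h : HomeoOn f g X Y) {X' : Set α} (hX : X' ⊆ X) : HomeoOn f g X' (f '' X') := by
  refine h.mono hX ?_ (mapsTo_image f X') ?_
  · rintro _ ⟨x, hx, rfl⟩
    exact h.mapsf (hX hx)
  · rintro _ ⟨x, hx, rfl⟩
    rwa [h.left x (hX hx)]

theorem nonempty_homeomorph (h : HomeoOn f g X Y) : Nonempty (X ≃ₜ Y) :=
  ⟨{ toFun := h.mapsf.restrict
     invFun := h.mapsg.restrict
     left_inv := fun x ↦ Subtype.ext (h.left x x.2)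
     right_inv := fun y ↦ Subtype.ext (h.right y y.2)
     continuous_toFun := h.contf.mapsToRestrict h.mapsf
     continuous_invFun := h.contg.mapsToRestrict h.mapsg }⟩

theorem of_homeomorph [Nonempty α] [Nonempty β] (φ : X ≃ₜ Y) :
    ∃ f : α → β, ∃ g : β → α, HomeoOn f g X Y := by
  classical
  obtain ⟨a⟩ := ‹Nonempty α›
  obtain ⟨b⟩ := ‹Nonempty β›
  refine ⟨fun x ↦ if hx : x ∈ X then φ ⟨x, hx⟩ else b,
    fun y ↦ if hy : y ∈ Y then φ.symm ⟨y, hy⟩ else a, ?_, ?_, ?_, ?_, ?_, ?_⟩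
  · rw [continuousOn_iff_continuous_domRestrict]
    exact (continuous_subtype_val.comp φ.continuous).congr fun x ↦ by simp
  · rw [continuousOn_iff_continuous_domRestrict]
    exact (continuous_subtype_val.comp φ.symm.continuous).congr fun x ↦ by simp
  · intro x hx
    simp [hx]
  · intro y hy
    simp [hy]
  · intro x hx
    simp [hx]
  · intro y hy
    simp [hy]

theorem continuousOn_piecewise_of_isClosed {f q : α → β} {A B X : Set α} [DecidablePred (· ∈ A)]
    (hA : IsClosed A) (hB : IsClosed B) (hX : X ⊆ A ∪ B) (hf : ContinuousOn f (X ∩ A))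
    (hq : ContinuousOn q (X ∩ B)) (hfq : ∀ x ∈ X, x ∈ A → x ∈ B → f x = q x) :
    ContinuousOn (A.piecewise f q) X := by
  have hF : ContinuousOn (A.piecewise f q) (X ∩ A) :=
    hf.congr fun x hx ↦ piecewise_eq_of_mem _ _ _ hx.2
  have hQ : ContinuousOn (A.piecewise f q) (X ∩ B) := hq.congr fun x hx ↦ by
    by_cases hxA : x ∈ A
    · rw [piecewise_eq_of_mem _ _ _ hxA, hfq x hx.1 hxA hx.2]
    · rw [piecewise_eq_of_notMem _ _ _ hxA]
  have hXAB : X = X ∩ A ∪ X ∩ B := by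
    rw [← inter_union_distrib_left, inter_eq_left.2 hX]
  intro x hx
  rw [hXAB]
  refine ContinuousWithinAt.union ?_ ?_
  · by_cases hxA : x ∈ A
    · exact hF x ⟨hx, hxA⟩
    · exact continuousWithinAt_of_notMem_closure fun h ↦
        hxA (hA.closure_subset_iff.2 inter_subset_right h)
  · by_cases hxB : x ∈ B
    · exact hQ x ⟨hx, hxB⟩
    · exact continuousWithinAt_of_notMem_closure fun h ↦
        hxB (hB.closure_subset_iff.2 inter_subset_right h)

/-- Gluing two homeomorphisms along relatively closed pieces. -/
theorem glue {q : α → β} {p : β → α} {A B : Set α} {A' B' : Set β}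
    (hA : IsClosed A) (hB : IsClosed B) (hA' : IsClosed A') (hB' : IsClosed B')
    (hX : X ⊆ A ∪ B) (hY : Y ⊆ A' ∪ B')
    (hf : HomeoOn f g (X ∩ A) (Y ∩ A')) (hq : HomeoOn q p (X ∩ B) (Y ∩ B'))
    (hfq : ∀ x ∈ X, x ∈ A → x ∈ B → f x = q x)
    (hgp : ∀ y ∈ Y, y ∈ A' → y ∈ B' → g y = p y) :
    ∃ F : α → β, ∃ G : β → α, HomeoOn F G X Y ∧ (∀ x ∈ X, x ∈ A → F x = f x) ∧
      ∀ y ∈ Y, y ∈ A' → G y = g y := by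
  classical
  have hFA : ∀ x ∈ X, x ∈ A → A.piecewise f q x = f x := fun x _ hx ↦
    piecewise_eq_of_mem _ _ _ hx
  have hGA : ∀ y ∈ Y, y ∈ A' → A'.piecewise g p y = g y := fun y _ hy ↦
    piecewise_eq_of_mem _ _ _ hy
  have hFB : ∀ x ∈ X, x ∈ B → A.piecewise f q x = q x := fun x hx hxB ↦ by
    by_cases hxA : x ∈ A
    · rw [hFA x hx hxA, hfq x hx hxA hxB]
    · exact piecewise_eq_of_notMem _ _ _ hxA
  have hGB : ∀ y ∈ Y, y ∈ B' → A'.piecewise g p y = p y := fun y hy hyB ↦ by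
    by_cases hyA : y ∈ A'
    · rw [hGA y hy hyA, hgp y hy hyA hyB]
    · exact piecewise_eq_of_notMem _ _ _ hyA
  refine ⟨A.piecewise f q, A'.piecewise g p, ⟨?_, ?_, ?_, ?_, ?_, ?_⟩, hFA, hGA⟩
  · exact continuousOn_piecewise_of_isClosed hA hB hX hf.contf hq.contf hfq
  · exact continuousOn_piecewise_of_isClosed hA' hB' hY hf.contg hq.contg hgp
  · intro x hx
    rcases hX hx with h | h
    · rw [hFA x hx h]
      exact (hf.mapsf ⟨hx, h⟩).1
    · rw [hFB x hx h]
      exact (hq.mapsf ⟨hx, h⟩).1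
  · intro y hy
    rcases hY hy with h | h
    · rw [hGA y hy h]
      exact (hf.mapsg ⟨hy, h⟩).1
    · rw [hGB y hy h]
      exact (hq.mapsg ⟨hy, h⟩).1
  · intro x hx
    rcases hX hx with h | h
    · have := hf.mapsf ⟨hx, h⟩
      rw [hFA x hx h, hGA _ this.1 this.2, hf.left x ⟨hx, h⟩]
    · have := hq.mapsf ⟨hx, h⟩
      rw [hFB x hx h, hGB _ this.1 this.2, hq.left x ⟨hx, h⟩]
  · intro y hy
    rcases hY hy with h | h
    · have := hf.mapsg ⟨hy, h⟩
      rw [hGA y hy h, hFA _ this.1 this.2, hf.right y ⟨hy, h⟩]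
    · have := hq.mapsg ⟨hy, h⟩
      rw [hGB y hy h, hFB _ this.1 this.2, hq.right y ⟨hy, h⟩]

end HomeoOn

/-- The closed unit disc with one boundary point removed is convex. -/
theorem convex_closedBall_diff_singleton {p : ℂ} (hp : ‖p‖ = 1) :
    Convex ℝ (Metric.closedBall (0 : ℂ) 1 \ {p}) := by
  have hpA : p ∈ Metric.closedBall (0 : ℂ) 1 := by simp [hp]
  refine ((convex_closedBall (0 : ℂ) 1).mem_extremePoints_iff_convex_sdiff.1
    (mem_extremePoints_iff_left.2 ⟨hpA, fun x hx y hy hxy ↦ ?_⟩)).2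
  by_contra hne
  rcases eq_or_ne x y with rfl | hxy'
  · rw [openSegment_same] at hxy
    exact hne hxy.symm
  · have := (strictConvex_closedBall ℝ (0 : ℂ) 1).openSegment_subset hx hy hxy' hxy
    rw [interior_closedBall _ one_ne_zero] at this
    simp [hp] at this

/-- A homeomorphism between relatively open subsets of the unit disc preserves the unit circle. -/
theorem HomeoOn.norm_eq_one {f g : ℂ → ℂ} {U V : Set ℂ} (hU : IsOpen U) (hV : IsOpen V)
    (h : HomeoOn f g (U ∩ Metric.closedBall 0 1) (V ∩ Metric.closedBall 0 1))
    {p : ℂ} (hpU : p ∈ U) (hp : ‖p‖ = 1) : ‖f p‖ = 1 := by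
  by_contra hne
  have hpP : p ∈ U ∩ Metric.closedBall (0 : ℂ) 1 := ⟨hpU, by simp [hp]⟩
  have hqQ := h.mapsf hpP
  set q := f p with hq
  have hgq : g q = p := h.left p hpP
  have hq1 : q ∈ Metric.ball (0 : ℂ) 1 := by
    have := hqQ.2
    simp only [Metric.mem_closedBall, dist_zero_right, Metric.mem_ball] at this ⊢
    exact lt_of_le_of_ne this hne
  obtain ⟨ρ, hρ, hρU⟩ := Metric.isOpen_iff.1 hU p hpU
  set C := (Metric.ball p ρ) ∩ (Metric.closedBall (0 : ℂ) 1 \ {p}) with hC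
  have hCconv : Convex ℝ C := (convex_ball p ρ).inter (convex_closedBall_diff_singleton hp)
  have hCP : C ⊆ U ∩ Metric.closedBall 0 1 := fun z hz ↦ ⟨hρU hz.1, hz.2.1⟩
  have hQ : V ∩ Metric.ball (0 : ℂ) 1 ∈ 𝓝 q := (hV.inter Metric.isOpen_ball).mem_nhds ⟨hqQ.1, hq1⟩
  have hQ' : V ∩ Metric.closedBall (0 : ℂ) 1 ∈ 𝓝 q :=
    mem_of_superset hQ (inter_subset_inter_right _ Metric.ball_subset_closedBall)
  have hgc : ContinuousAt g q := h.contg.continuousAt hQ'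
  have hpre : g ⁻¹' Metric.ball p ρ ∈ 𝓝 q :=
    hgc.preimage_mem_nhds (by rw [hgq]; exact Metric.ball_mem_nhds p hρ)
  obtain ⟨s, hs, hsub⟩ := Metric.nhds_basis_closedBall.mem_iff.1 (inter_mem hQ' hpre)
  have hcirc : ∀ z : Circle, q + s * z ∈ Metric.closedBall q s := fun z ↦ by
    rw [Metric.mem_closedBall, dist_self_add_left, norm_mul, Circle.norm_coe, mul_one,
      Complex.norm_real, Real.norm_of_nonneg hs.le]
  have hsz : ∀ z : Circle, (s : ℂ) * z ≠ 0 := fun z ↦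
    mul_ne_zero (by exact_mod_cast hs.ne') z.coe_ne_zero
  have hgC : ∀ z : Circle, g (q + s * z) ∈ C := by
    intro z
    have h1 := hsub (hcirc z)
    refine ⟨h1.2, (h.mapsg h1.1).2, fun h2 ↦ ?_⟩
    have h3 := h.right _ h1.1
    rw [mem_singleton_iff.1 h2, ← hq] at h3
    exact hsz z (by simpa using h3.symm)
  have hgcont : Continuous fun z : Circle ↦ g (q + s * z) := by
    refine h.contg.comp_continuous (by fun_prop) fun z ↦ (hsub (hcirc z)).1
  have hmem : ∀ x : unitInterval × Circle,
      g (q + s * (1 : Circle)) + (x.1 : ℝ) • (g (q + s * x.2) - g (q + s * (1 : Circle))) ∈ C :=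
    fun x ↦ hCconv.add_smul_sub_mem (hgC 1) (hgC x.2) x.1.2
  have hcont : Continuous fun x : unitInterval × Circle ↦
      f (g (q + s * (1 : Circle)) + (x.1 : ℝ) • (g (q + s * x.2) - g (q + s * (1 : Circle)))) -
        q := by
    refine (h.contf.comp_continuous ?_ fun x ↦ hCP (hmem x)).sub continuous_const
    have := hgcont.comp (continuous_snd (X := unitInterval))
    have h' : Continuous fun x : unitInterval × Circle ↦ (x.1 : ℝ) := by fun_prop
    exact continuous_const.add (h'.smul (this.sub continuous_const))
  have hne0 : ∀ x : unitInterval × Circle,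
      f (g (q + s * (1 : Circle)) + (x.1 : ℝ) • (g (q + s * x.2) - g (q + s * (1 : Circle)))) - q
        ≠ 0 := by
    intro x hx
    have h1 := h.left _ (hCP (hmem x))
    rw [sub_eq_zero.1 hx, hgq] at h1
    exact (hmem x).2.2 h1.symm
  refine no_contraction_of_circle ⟨fun x ↦ ⟨_, hne0 x⟩, hcont.subtype_mk _⟩ s
    ⟨s * (1 : Circle), hsz 1⟩ ?_ ?_
  · intro z
    apply Subtype.ext
    have := h.right _ (hsub (hcirc 1)).1
    simp only [ContinuousMap.coe_mk, Set.Icc.coe_zero, zero_smul, add_zero, this,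
      add_sub_cancel_left]
  · intro z
    have := h.right _ (hsub (hcirc z)).1
    simp only [ContinuousMap.coe_mk, Set.Icc.coe_one, one_smul, add_sub_cancel, this,
      add_sub_cancel_left]

/-- The annulus as the punctured plane; height zero corresponds to the unit circle and positive
heights to the interior of the disc. -/
def toPlane (p : Ann) : ℂ := Real.exp (-p.2) * AddCircle.toCircle p.1

/-- The radial projection of the punctured plane to the unit circle. -/
def unitDirection (z : ℂ) (hz : z ≠ 0) : Circle :=
  ⟨z / ‖z‖, by simp [Submonoid.unitSphere, hz]⟩

theorem coe_unitDirection (z : ℂ) (hz : z ≠ 0) : (unitDirection z hz : ℂ) = z / ‖z‖ := rfl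

open Classical in
/-- The inverse of `toPlane`. -/
def ofPlane (z : ℂ) : Ann :=
  if hz : z ≠ 0 then
    ((AddCircle.homeomorphCircle one_ne_zero).symm
      (unitDirection z hz), -Real.log ‖z‖)
  else 0

theorem norm_toPlane (p : Ann) : ‖toPlane p‖ = Real.exp (-p.2) := by
  rw [toPlane, norm_mul, Circle.norm_coe, mul_one, Complex.norm_real,
    Real.norm_of_nonneg (Real.exp_pos _).le]

theorem toPlane_ne_zero (p : Ann) : toPlane p ≠ 0 := by
  rw [← norm_pos_iff, norm_toPlane]
  exact Real.exp_pos _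

theorem homeoOn_toPlane : HomeoOn toPlane ofPlane univ {0}ᶜ where
  contf := by
    have : Continuous toPlane := by
      unfold toPlane
      have h1 : Continuous fun p : Ann ↦ (AddCircle.toCircle p.1 : ℂ) :=
        continuous_subtype_val.comp (AddCircle.continuous_toCircle.comp continuous_fst)
      fun_prop
    exact this.continuousOn
  contg := by
    rw [continuousOn_iff_continuous_domRestrict]
    have h0 : ∀ z : ({0}ᶜ : Set ℂ), (z : ℂ) ≠ 0 := fun z ↦ z.2
    have h1 : Continuous fun z : ({0}ᶜ : Set ℂ) ↦
        ((AddCircle.homeomorphCircle one_ne_zero).symm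
        (unitDirection z (h0 z)), -Real.log ‖(z : ℂ)‖) := by
      refine Continuous.prodMk ?_ ?_
      · refine (Homeomorph.continuous _).comp (Continuous.subtype_mk ?_ _)
        refine continuous_subtype_val.div (by fun_prop) fun z ↦ ?_
        simpa using h0 z
      · exact (Continuous.log (by fun_prop) fun z ↦ by simpa using h0 z).neg
    refine h1.congr fun z ↦ ?_
    rw [domRestrict_apply, ofPlane, dif_pos (h0 z)]
  mapsf p _ := toPlane_ne_zero p
  mapsg _ _ := mem_univ _
  left p _ := by
    rw [ofPlane, dif_pos (toPlane_ne_zero p)]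
    refine Prod.ext ?_ ?_
    · dsimp only
      rw [Homeomorph.symm_apply_eq, AddCircle.homeomorphCircle_apply]
      apply Circle.ext
      rw [coe_unitDirection, norm_toPlane, toPlane, mul_div_cancel_left₀]
      exact_mod_cast (Real.exp_pos _).ne'
    · simp [norm_toPlane]
  right z hz := by
    have hz : z ≠ 0 := hz
    rw [ofPlane, dif_pos hz, toPlane]
    dsimp only
    rw [← AddCircle.homeomorphCircle_apply one_ne_zero, Homeomorph.apply_symm_apply, neg_neg,
      Real.exp_log (norm_pos_iff.2 hz), coe_unitDirection]
    have : (‖z‖ : ℂ) ≠ 0 := by simpa using hz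
    field_simp

/-- A homeomorphism between relatively open subsets of the half-infinite closed annulus
preserves the boundary circle. -/
theorem HomeoOn.snd_eq_zero {f g : Ann → Ann} {U V : Set Ann} (hU : IsOpen U) (hV : IsOpen V)
    (h : HomeoOn f g (U ∩ {p | 0 ≤ p.2}) (V ∩ {p | 0 ≤ p.2}))
    {p : Ann} (hpU : p ∈ U) (hp : p.2 = 0) : (f p).2 = 0 := by
  have key : ∀ W : Set Ann, HomeoOn ofPlane toPlane
      (({0}ᶜ ∩ ofPlane ⁻¹' W) ∩ Metric.closedBall 0 1) (W ∩ {p | 0 ≤ p.2}) := by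
    intro W
    refine homeoOn_toPlane.symm.mono (fun z hz ↦ hz.1.1) (subset_univ _) ?_ ?_
    · rintro z ⟨⟨hz0, hzW⟩, hz1⟩
      refine ⟨hzW, ?_⟩
      rw [← homeoOn_toPlane.right z hz0, mem_closedBall_zero_iff, norm_toPlane,
        Real.exp_le_one_iff] at hz1
      simpa using hz1
    · rintro x ⟨hxW, hx0⟩
      refine ⟨⟨toPlane_ne_zero x, ?_⟩, ?_⟩
      · rwa [mem_preimage, homeoOn_toPlane.left x (mem_univ _)]
      · rw [mem_closedBall_zero_iff, norm_toPlane, Real.exp_le_one_iff]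
        simpa using hx0
  have hop : ∀ W : Set Ann, IsOpen W → IsOpen ({0}ᶜ ∩ ofPlane ⁻¹' W) := fun W hW ↦
    homeoOn_toPlane.contg.isOpen_inter_preimage isOpen_compl_singleton hW
  have hF := ((key U).trans h).trans (key V).symm
  have := hF.norm_eq_one (hop U hU) (hop V hV) (p := toPlane p)
    ⟨toPlane_ne_zero p, by rwa [mem_preimage, homeoOn_toPlane.left p (mem_univ _)]⟩
    (by simp [norm_toPlane, hp])
  simpa [norm_toPlane, homeoOn_toPlane.left p (mem_univ _)] using this

theorem halfOpenAnn_eq : halfOpenAnn = {p : Ann | p.2 < 1} ∩ {p | 0 ≤ p.2} := by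
  ext p
  simp [halfOpenAnn, and_comm]

/-- A half-open annulus in the standard one, containing its boundary circle, is homeomorphic to
the model relative to this circle. -/
theorem exists_homeoOn_halfOpenAnn_eq_self {M U : Set Ann} (hU : IsOpen U)
    (hM : M = U ∩ {p | 0 ≤ p.2}) (hlow : bdLow ⊆ M) (φ : M ≃ₜ halfOpenAnn) :
    ∃ f g : Ann → Ann, HomeoOn f g M halfOpenAnn ∧ ∀ p : Ann, p.2 = 0 → f p = p ∧ g p = p := by
  obtain ⟨f, g, h⟩ := HomeoOn.of_homeomorph φ
  have hV : IsOpen {p : Ann | p.2 < 1} := isOpen_lt continuous_snd continuous_const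
  have hf : ∀ p : Ann, p.2 = 0 → (f p).2 = 0 := fun p hp ↦ by
    rw [hM, halfOpenAnn_eq] at h
    exact h.snd_eq_zero hU hV (hM ▸ hlow hp : p ∈ U ∩ _).1 hp
  have hg : ∀ p : Ann, p.2 = 0 → (g p).2 = 0 := fun p hp ↦ by
    rw [hM, halfOpenAnn_eq] at h
    exact h.symm.snd_eq_zero hV hU (by simp [hp]) hp
  have hmem : ∀ x : Circ, ((x, 0) : Ann) ∈ M := fun x ↦ hlow rfl
  have hmem' : ∀ x : Circ, ((x, 0) : Ann) ∈ halfOpenAnn := fun x ↦ by simp [halfOpenAnn]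
  have hσ : Continuous fun x : Circ ↦ (f (x, 0)).1 :=
    continuous_fst.comp (h.contf.comp_continuous (by fun_prop) hmem)
  have hτ : Continuous fun x : Circ ↦ (g (x, 0)).1 :=
    continuous_fst.comp (h.contg.comp_continuous (by fun_prop) hmem')
  have hστ : ∀ x, (f ((g (x, 0)).1, 0)).1 = x := fun x ↦ by
    have : (((g (x, 0)).1, 0) : Ann) = g (x, 0) := Prod.ext rfl (hg (x, 0) rfl).symm
    rw [this, h.right _ (hmem' x)]
  have hτσ : ∀ x, (g ((f (x, 0)).1, 0)).1 = x := fun x ↦ by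
    have : (((f (x, 0)).1, 0) : Ann) = f (x, 0) := Prod.ext rfl (hf (x, 0) rfl).symm
    rw [this, h.left _ (hmem x)]
  have htwist : HomeoOn (fun p : Ann ↦ ((g (p.1, 0)).1, p.2)) (fun p : Ann ↦ ((f (p.1, 0)).1, p.2))
      halfOpenAnn halfOpenAnn :=
    ⟨((hτ.comp continuous_fst).prodMk continuous_snd).continuousOn,
      ((hσ.comp continuous_fst).prodMk continuous_snd).continuousOn,
      fun p hp ↦ hp, fun p hp ↦ hp, fun p _ ↦ by simp [hστ], fun p _ ↦ by simp [hτσ]⟩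
  refine ⟨_, _, h.trans htwist, ?_⟩
  rintro ⟨x, t⟩ rfl
  constructor
  · simp [hτσ, hf]
  · have : (((f (x, 0)).1, 0) : Ann) = f (x, 0) := Prod.ext rfl (hf (x, 0) rfl).symm
    simp [this, h.left _ (hmem x)]

theorem exists_homeoOn_range {α β : Type*} [TopologicalSpace α] [TopologicalSpace β] [Nonempty α]
    {h : α → β} (hh : IsOpenEmbedding h) : ∃ k : β → α, HomeoOn h k univ (range h) := by
  refine ⟨(hh.toOpenPartialHomeomorph h).symm, hh.continuous.continuousOn, ?_, ?_,
    fun _ _ ↦ mem_univ _, fun x _ ↦ hh.toOpenPartialHomeomorph_left_inv h, ?_⟩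
  · simpa using (hh.toOpenPartialHomeomorph h).continuousOn_symm
  · exact fun x _ ↦ mem_range_self x
  · rintro _ ⟨x, rfl⟩
    rw [hh.toOpenPartialHomeomorph_left_inv h]

/-- Extending a half-open annulus by a collar and contracting the result into the collar. -/
theorem exists_homeoOn_collar_union {M U : Set Ann} (hU : IsOpen U)
    (hM : M = U ∩ {p | 0 ≤ p.2}) (hlow : bdLow ⊆ M) (φ : M ≃ₜ halfOpenAnn) :
    ∃ f g : Ann → Ann, HomeoOn f g ({p | p.2 ∈ Ico (-1 : ℝ) 0} ∪ M) {p | p.2 ∈ Ico (-1 : ℝ) 0} ∧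
      ∀ p : Ann, p.2 = -1 → f p = p ∧ g p = p := by
  obtain ⟨f, g, h, hfix⟩ := exists_homeoOn_halfOpenAnn_eq_self hU hM hlow φ
  have hA : IsClosed {p : Ann | p.2 ≤ 0} := isClosed_le continuous_snd continuous_const
  have hB : IsClosed {p : Ann | 0 ≤ p.2} := isClosed_le continuous_const continuous_snd
  have hM0 : ∀ p ∈ M, 0 ≤ p.2 := fun p hp ↦ by
    rw [hM] at hp
    exact hp.2
  have hXB : ({p : Ann | p.2 ∈ Ico (-1 : ℝ) 0} ∪ M) ∩ {p | 0 ≤ p.2} = M := by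
    ext p
    constructor
    · rintro ⟨hp | hp, hp'⟩
      · exact absurd hp.2 (not_lt.2 hp')
      · exact hp
    · exact fun hp ↦ ⟨Or.inr hp, hM0 p hp⟩
  have hXA : ({p : Ann | p.2 ∈ Ico (-1 : ℝ) 0} ∪ M) ∩ {p | p.2 ≤ 0} =
      {p | p.2 ∈ Icc (-1 : ℝ) 0} := by
    ext p
    constructor
    · rintro ⟨hp | hp, hp'⟩
      · exact ⟨hp.1, hp'⟩
      · exact ⟨by linarith [hM0 p hp], hp'⟩
    · intro hp
      refine ⟨?_, hp.2⟩
      rcases hp.2.lt_or_eq with h' | h'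
      · exact Or.inl ⟨hp.1, h'⟩
      · exact Or.inr (hlow h')
  have hYB : {p : Ann | p.2 ∈ Ico (-1 : ℝ) 1} ∩ {p | 0 ≤ p.2} = halfOpenAnn := by
    ext p
    simp only [halfOpenAnn, mem_inter_iff, mem_ofPred_eq, mem_Ico]
    constructor
    · exact fun hp ↦ ⟨hp.2, hp.1.2⟩
    · exact fun hp ↦ ⟨⟨by linarith, hp.2⟩, hp.1⟩
  have hYA : {p : Ann | p.2 ∈ Ico (-1 : ℝ) 1} ∩ {p | p.2 ≤ 0} = {p | p.2 ∈ Icc (-1 : ℝ) 0} := by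
    ext p
    simp only [mem_inter_iff, mem_ofPred_eq, mem_Ico, mem_Icc]
    constructor
    · exact fun hp ↦ ⟨hp.1.1, hp.2⟩
    · exact fun hp ↦ ⟨⟨hp.1, by linarith⟩, hp.2⟩
  obtain ⟨F, G, hFG, hF, hG⟩ := HomeoOn.glue
    (X := {p : Ann | p.2 ∈ Ico (-1 : ℝ) 0} ∪ M) (Y := {p : Ann | p.2 ∈ Ico (-1 : ℝ) 1})
    (f := id) (g := id) (q := f) (p := g) hA hB hA hB (fun p _ ↦ le_total p.2 0)
    (fun p _ ↦ le_total p.2 0) (by rw [hXA, hYA]; exact HomeoOn.refl _) (by rwa [hXB, hYB])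
    (fun p _ h1 h2 ↦ (hfix p (le_antisymm h1 h2)).1.symm)
    (fun p _ h1 h2 ↦ (hfix p (le_antisymm h1 h2)).2.symm)
  have hscale : HomeoOn (fun p : Ann ↦ (p.1, (p.2 - 1) / 2)) (fun p : Ann ↦ (p.1, 2 * p.2 + 1))
      {p | p.2 ∈ Ico (-1 : ℝ) 1} {p | p.2 ∈ Ico (-1 : ℝ) 0} := by
    refine ⟨by fun_prop, by fun_prop, ?_, ?_, ?_, ?_⟩
    · rintro p ⟨h1, h2⟩
      exact ⟨by dsimp only; linarith, by dsimp only; linarith⟩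
    · rintro p ⟨h1, h2⟩
      exact ⟨by dsimp only; linarith, by dsimp only; linarith⟩
    · rintro ⟨x, t⟩ -
      refine Prod.ext rfl ?_
      dsimp only
      ring
    · rintro ⟨x, t⟩ -
      refine Prod.ext rfl ?_
      dsimp only
      ring
  refine ⟨_, _, hFG.trans hscale, ?_⟩
  rintro ⟨x, t⟩ rfl
  have h1 := hF (x, -1) (Or.inl (by norm_num)) (by norm_num)
  have h2 := hG (x, -1) (by norm_num) (by norm_num)
  constructor
  · rw [Function.comp, h1]
    norm_num
  · norm_num [h2]

/-- Attaching a half-open annulus to `L` along a collar does not change the homeomorphism type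
of `L`. -/
theorem nonempty_homeomorph_union_image {h : Ann → Ann} (hh : IsOpenEmbedding h)
    {L M U : Set Ann} (hU : IsOpen U) (hM : M = U ∩ {p | 0 ≤ p.2}) (hM1 : ∀ p ∈ M, p.2 < 1)
    (hlow : bdLow ⊆ M) (φ : M ≃ₜ halfOpenAnn) (hL0 : ∀ p : Ann, p.2 < 0 → h p ∈ L)
    (hL : ∀ p : Ann, 0 ≤ p.2 → h p ∉ L) : Nonempty (↥(L ∪ h '' M) ≃ₜ L) := by
  obtain ⟨f, g, hfg, hfix⟩ := exists_homeoOn_collar_union hU hM hlow φ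
  obtain ⟨k, hk⟩ := exists_homeoOn_range hh
  have hkh : ∀ p, k (h p) = p := fun p ↦ hk.left p (mem_univ p)
  have hM0 : ∀ p ∈ M, 0 ≤ p.2 := fun p hp ↦ by
    rw [hM] at hp
    exact hp.2
  have hmid := ((hk.image (subset_univ _)).symm.trans hfg).trans (hk.image (subset_univ _))
  have hA : IsClosed (h '' {p | -1 < p.2})ᶜ :=
    (hh.isOpenMap _ (isOpen_lt continuous_const continuous_snd)).isClosed_compl
  have hB : IsClosed (h '' {p | p.2 ∈ Icc (-1 : ℝ) 1}) := by
    have : IsCompact {p : Ann | p.2 ∈ Icc (-1 : ℝ) 1} := by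
      convert! (isCompact_univ (X := Circ)).prod (isCompact_Icc (a := (-1 : ℝ)) (b := 1)) using 1
      ext p
      simp
    exact (this.image hh.continuous).isClosed
  have hcover : ∀ X ⊆ L ∪ h '' M,
      X ⊆ (h '' {p | -1 < p.2})ᶜ ∪ h '' {p | p.2 ∈ Icc (-1 : ℝ) 1} := by
    intro X hX x hx
    by_cases hxA : x ∈ h '' {p | -1 < p.2}
    · obtain ⟨p, hp, rfl⟩ := hxA
      refine Or.inr (mem_image_of_mem h ⟨hp.le, ?_⟩)
      by_contra hp1
      rcases hX hx with h' | ⟨p', hp', h'⟩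
      · exact hL p (by linarith) h'
      · rw [hh.injective h'] at hp'
        linarith [hM1 p hp']
    · exact Or.inl hxA
  have hXA : (L ∪ h '' M) ∩ (h '' {p | -1 < p.2})ᶜ = L ∩ (h '' {p | -1 < p.2})ᶜ := by
    ext x
    constructor
    · rintro ⟨hx | ⟨p, hp, rfl⟩, hx'⟩
      · exact ⟨hx, hx'⟩
      · exact absurd (mem_image_of_mem h (show -1 < p.2 by linarith [hM0 p hp])) hx'
    · exact fun hx ↦ ⟨Or.inl hx.1, hx.2⟩
  have hXB : (L ∪ h '' M) ∩ h '' {p | p.2 ∈ Icc (-1 : ℝ) 1} =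
      h '' ({p | p.2 ∈ Ico (-1 : ℝ) 0} ∪ M) := by
    ext x
    constructor
    · rintro ⟨hx, p, hp, rfl⟩
      refine mem_image_of_mem h ?_
      rcases hx with hx | ⟨p', hp', h'⟩
      · exact Or.inl ⟨hp.1, by by_contra h'; exact hL p (not_lt.1 h') hx⟩
      · rw [← hh.injective h']
        exact Or.inr hp'
    · rintro ⟨p, hp | hp, rfl⟩
      · exact ⟨Or.inl (hL0 p hp.2), mem_image_of_mem h ⟨hp.1, by linarith [hp.2]⟩⟩
      · exact ⟨Or.inr (mem_image_of_mem h hp),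
          mem_image_of_mem h ⟨by linarith [hM0 p hp], (hM1 p hp).le⟩⟩
  have hYB : L ∩ h '' {p | p.2 ∈ Icc (-1 : ℝ) 1} = h '' {p | p.2 ∈ Ico (-1 : ℝ) 0} := by
    ext x
    constructor
    · rintro ⟨hx, p, hp, rfl⟩
      exact mem_image_of_mem h ⟨hp.1, by by_contra h'; exact hL p (not_lt.1 h') hx⟩
    · rintro ⟨p, hp, rfl⟩
      exact ⟨hL0 p hp.2, mem_image_of_mem h ⟨hp.1, by linarith [hp.2]⟩⟩
  have hoverlap : ∀ p : Ann, h p ∈ (h '' {p | -1 < p.2})ᶜ → p.2 ∈ Icc (-1 : ℝ) 1 → p.2 = -1 :=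
    fun p h1 h2 ↦ le_antisymm (not_lt.1 fun h3 ↦ h1 (mem_image_of_mem h h3)) h2.1
  obtain ⟨F, G, hFG, -, -⟩ := HomeoOn.glue (X := L ∪ h '' M) (Y := L) (f := id) (g := id)
    hA hB hA hB (hcover _ subset_rfl) (hcover _ subset_union_left)
    (by rw [hXA]; exact HomeoOn.refl _) (by rw [hXB, hYB]; exact hmid)
    (by
      rintro _ - h1 ⟨p, h2, rfl⟩
      simp [hkh, (hfix p (hoverlap p h1 h2)).1])
    (by
      rintro _ - h1 ⟨p, h2, rfl⟩
      simp [hkh, (hfix p (hoverlap p h1 h2)).2])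
  exact hFG.nonempty_homeomorph

namespace TwoComponents

variable {W A B : Set Ann}

theorem of_separated (hA : A.Nonempty) (hB : B.Nonempty) (hA' : IsPreconnected A)
    (hB' : IsPreconnected B) (hW : A ∪ B = W) (hAB : Disjoint (closure A) B)
    (hBA : Disjoint A (closure B)) : TwoComponents W A B := by
  have key : ∀ {A B : Set Ann}, IsPreconnected A → A ∪ B = W → Disjoint (closure A) B →
      Disjoint A (closure B) → ∀ x ∈ A, connectedComponentIn W x = A := by
    intro A B hA' hW hAB hBA x hx
    refine Subset.antisymm (fun y hy ↦ ?_)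
      (hA'.subset_connectedComponentIn hx (hW ▸ subset_union_left))
    by_contra hyA
    have hsub := connectedComponentIn_subset W x
    have hmem : ∀ z ∈ connectedComponentIn W x, z ∈ A ∨ z ∈ B := fun z hz ↦ by
      have := hsub hz
      rwa [← hW] at this
    have hyB : y ∈ B := (hmem y hy).resolve_left hyA
    obtain ⟨z, hz, hz1, hz2⟩ := isPreconnected_connectedComponentIn (F := W) (x := x)
      (closure B)ᶜ (closure A)ᶜ isClosed_closure.isOpen_compl isClosed_closure.isOpen_compl
      (fun z hz ↦ (hmem z hz).imp (fun h ↦ disjoint_left.1 hBA h) fun h ↦ disjoint_right.1 hAB h)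
      ⟨x, mem_connectedComponentIn (hW ▸ Or.inl hx), disjoint_left.1 hBA hx⟩
      ⟨y, hy, disjoint_right.1 hAB hyB⟩
    rcases hmem z hz with h | h
    · exact hz2 (subset_closure h)
    · exact hz1 (subset_closure h)
  have hcA := key hA' hW hAB hBA
  have hcB := key hB' ((union_comm _ _).trans hW) hBA.symm hAB.symm
  refine ⟨?_, hW, ?_, ?_, fun x hx ↦ ?_⟩
  · rintro rfl
    obtain ⟨x, hx⟩ := hA
    exact disjoint_left.1 hBA hx (subset_closure hx)
  · obtain ⟨x, hx⟩ := hA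
    exact ⟨x, hW ▸ Or.inl hx, hcA x hx⟩
  · obtain ⟨x, hx⟩ := hB
    exact ⟨x, hW ▸ Or.inr hx, hcB x hx⟩
  · rw [← hW] at hx
    exact hx.imp (hcA x) (hcB x)

theorem symm (h : TwoComponents W A B) : TwoComponents W B A :=
  ⟨h.1.symm, (union_comm _ _).trans h.2.1, h.2.2.2.1, h.2.2.1, fun x hx ↦ (h.2.2.2.2 x hx).symm⟩

theorem nonempty_left (h : TwoComponents W A B) : A.Nonempty := by
  obtain ⟨x, hx, rfl⟩ := h.2.2.1
  exact connectedComponentIn_nonempty_iff.2 hx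

theorem isPreconnected_left (h : TwoComponents W A B) : IsPreconnected A := by
  obtain ⟨x, hx, rfl⟩ := h.2.2.1
  exact isPreconnected_connectedComponentIn

theorem disjoint_closure_left (h : TwoComponents W A B) : Disjoint (closure A) B := by
  obtain ⟨hne, -, ⟨x, hx, rfl⟩, ⟨y, hy, rfl⟩, -⟩ := h
  rw [disjoint_left]
  intro z hz hz'
  have hzW := connectedComponentIn_subset W y hz'
  have hsub : insert z (connectedComponentIn W x) ⊆ connectedComponentIn W x := by
    refine IsPreconnected.subset_connectedComponentIn ?_
      (mem_insert_of_mem z (mem_connectedComponentIn hx))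
      (insert_subset hzW (connectedComponentIn_subset W x))
    exact isPreconnected_connectedComponentIn.subset_closure (subset_insert _ _)
      (insert_subset hz subset_closure)
  exact hne ((connectedComponentIn_eq (hsub (mem_insert _ _))).trans
    (connectedComponentIn_eq hz').symm)

theorem subset_or_subset (h : TwoComponents W A B) {S : Set Ann} (hS : IsPreconnected S)
    (hSn : S.Nonempty) (hSW : S ⊆ W) : S ⊆ A ∨ S ⊆ B := by
  obtain ⟨x, hx⟩ := hSn
  have := hS.subset_connectedComponentIn hx hSW
  rcases h.2.2.2.2 x (hSW hx) with h' | h'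
  · exact Or.inl (this.trans h'.subset)
  · exact Or.inr (this.trans h'.subset)

theorem image (h : TwoComponents W A B) (e : Ann ≃ₜ Ann) :
    TwoComponents (e '' W) (e '' A) (e '' B) := by
  refine of_separated (h.nonempty_left.image e) (h.symm.nonempty_left.image e)
    (h.isPreconnected_left.image e e.continuous.continuousOn)
    (h.symm.isPreconnected_left.image e e.continuous.continuousOn)
    ((image_union _ _ _).symm.trans (by rw [h.2.1])) ?_ ?_
  · rw [← e.image_closure, disjoint_image_iff e.injective]
    exact h.disjoint_closure_left
  · rw [← e.image_closure, disjoint_image_iff e.injective]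
    exact h.symm.disjoint_closure_left.symm

end TwoComponents

theorem isCompact_stdA : IsCompact stdA := by
  convert! (isCompact_univ (X := Circ)).prod (isCompact_Icc (a := (0 : ℝ)) (b := 1)) using 1
  ext p
  simp [stdA]

theorem isPreconnected_snd_preimage {I : Set ℝ} (hI : IsPreconnected I) :
    IsPreconnected {p : Ann | p.2 ∈ I} := by
  convert! (isPreconnected_univ (α := Circ)).prod hI using 1
  ext p
  simp

/-- The reflection of the annulus exchanging the boundary circles of `stdA`. -/
def flipAnn : Ann ≃ₜ Ann := (Homeomorph.refl Circ).prodCongr (Homeomorph.subLeft (1 : ℝ))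

theorem flipAnn_apply (p : Ann) : flipAnn p = (p.1, 1 - p.2) := rfl

theorem flipAnn_flipAnn (p : Ann) : flipAnn (flipAnn p) = p := by
  simp [flipAnn_apply]

theorem image_flipAnn (X : Set Ann) : flipAnn '' X = flipAnn ⁻¹' X :=
  congrFun (image_eq_preimage_of_inverse flipAnn_flipAnn flipAnn_flipAnn) X

theorem flipAnn_image_stdA : flipAnn '' stdA = stdA := by
  rw [image_flipAnn]
  ext p
  simp [stdA, flipAnn_apply, and_comm]

namespace AnnularContinuum

variable {K Km Kp : Set Ann}

theorem flip (hK : AnnularContinuum K Km Kp) :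
    AnnularContinuum (flipAnn '' K) (flipAnn '' Kp) (flipAnn '' Km) := by
  obtain ⟨hc, hconn, hsub, htwo, hlow, hhigh, ⟨φ⟩, ⟨ψ⟩⟩ := hK
  refine ⟨hc.image flipAnn.continuous, hconn.image _ flipAnn.continuous.continuousOn, ?_, ?_,
    ?_, ?_, ⟨(flipAnn.image Kp).symm.trans ψ⟩, ⟨(flipAnn.image Km).symm.trans φ⟩⟩
  · exact (image_mono hsub).trans_eq flipAnn_image_stdA
  · rw [← flipAnn_image_stdA, ← image_sdiff flipAnn.injective]
    exact (htwo.image flipAnn).symm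
  · intro p hp
    rw [image_flipAnn]
    have hp : p.2 = 0 := hp
    exact hhigh (by simp [bdHigh, flipAnn_apply, hp])
  · intro p hp
    rw [image_flipAnn]
    have hp : p.2 = 1 := hp
    exact hlow (by simp [bdLow, flipAnn_apply, hp])

theorem two (hK : AnnularContinuum K Km Kp) : TwoComponents (stdA \ K) Km Kp := hK.2.2.2.1

theorem subset_diff_left (hK : AnnularContinuum K Km Kp) : Km ⊆ stdA \ K :=
  hK.two.2.1 ▸ subset_union_left

theorem subset_diff_right (hK : AnnularContinuum K Km Kp) : Kp ⊆ stdA \ K :=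
  hK.two.2.1 ▸ subset_union_right

theorem disjoint (hK : AnnularContinuum K Km Kp) : Disjoint Km Kp :=
  hK.two.disjoint_closure_left.mono_left subset_closure

theorem snd_lt_one (hK : AnnularContinuum K Km Kp) {p : Ann} (hp : p ∈ Km) : p.2 < 1 :=
  lt_of_le_of_ne (hK.subset_diff_left hp).1.2 fun h ↦
    disjoint_left.1 hK.disjoint hp (hK.2.2.2.2.2.1 h)

theorem snd_pos (hK : AnnularContinuum K Km Kp) {p : Ann} (hp : p ∈ Kp) : 0 < p.2 :=
  lt_of_le_of_ne (hK.subset_diff_right hp).1.1 fun h ↦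
    disjoint_right.1 hK.disjoint hp (hK.2.2.2.2.1 h.symm)

theorem exists_isOpen (hK : AnnularContinuum K Km Kp) :
    ∃ U, IsOpen U ∧ Km = U ∩ {p | 0 ≤ p.2} := by
  have hlt : IsOpen {p : Ann | p.2 < 1} := isOpen_lt continuous_snd continuous_const
  refine ⟨((closure Kp)ᶜ ∩ Kᶜ) ∩ {p | p.2 < 1},
    (isClosed_closure.isOpen_compl.inter hK.1.isClosed.isOpen_compl).inter hlt, ?_⟩
  ext p
  constructor
  · intro hp
    exact ⟨⟨⟨disjoint_right.1 hK.two.symm.disjoint_closure_left hp, (hK.subset_diff_left hp).2⟩,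
      hK.snd_lt_one hp⟩, (hK.subset_diff_left hp).1.1⟩
  · rintro ⟨⟨⟨h1, h2⟩, h3⟩, h4⟩
    have : p ∈ Km ∪ Kp := by
      rw [hK.two.2.1]
      exact ⟨⟨h4, le_of_lt h3⟩, h2⟩
    exact this.resolve_right fun h ↦ h1 (subset_closure h)

end AnnularContinuum

theorem disjoint_closure_union_image {h : Ann → Ann} (hh : IsOpenEmbedding h)
    {L L' M M' O : Set Ann} (hLL : Disjoint (closure L) L') (hMM : Disjoint (closure M) M')
    (hM : M ⊆ stdA) (hL' : Disjoint (h '' stdA) L') (hO : IsOpen O) (hM' : M' ⊆ O)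
    (hOL : Disjoint (h '' O) L) : Disjoint (closure (L ∪ h '' M)) (L' ∪ h '' M') := by
  have hcM : closure M ⊆ stdA := isCompact_stdA.isClosed.closure_subset_iff.2 hM
  have hcl : closure (h '' M) ⊆ h '' closure M :=
    closure_minimal (image_mono subset_closure)
      ((isCompact_stdA.of_isClosed_subset isClosed_closure hcM).image hh.continuous).isClosed
  rw [closure_union, disjoint_union_left, disjoint_union_right, disjoint_union_right]
  refine ⟨⟨hLL, ?_⟩, hL'.mono_left (hcl.trans (image_mono hcM)), ?_⟩
  · exact ((hOL.closure_right (hh.isOpenMap O hO)).mono_left (image_mono hM')).symm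
  · exact ((disjoint_image_iff hh.injective).2 hMM).mono_left hcl

theorem isPreconnected_union_image {h : Ann → Ann} (hh : Continuous h) {L M O : Set Ann}
    (hL : IsPreconnected L) (hM : IsPreconnected M) (hO : MapsTo h O L) {p : Ann} (hpM : p ∈ M)
    (hpO : p ∈ closure O) : IsPreconnected (L ∪ h '' M) := by
  have h1 : IsPreconnected (insert (h p) L) := hL.subset_closure (subset_insert _ _)
    (insert_subset (map_mem_closure hh hpO hO) subset_closure)
  have hm : h p ∈ L ∪ h '' M := Or.inr (mem_image_of_mem h hpM)
  have h2 := h1.union (h p) (mem_insert _ _) (mem_image_of_mem h hpM) (hM.image h hh.continuousOn)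
  rwa [insert_union, insert_eq_of_mem hm] at h2

theorem mem_closure_snd_preimage {I : Set ℝ} {x : Circ} {t : ℝ} (ht : t ∈ closure I) :
    (x, t) ∈ closure {p : Ann | p.2 ∈ I} :=
  map_mem_closure (f := fun t : ℝ ↦ ((x, t) : Ann)) (by fun_prop) ht fun _ hs ↦ hs

namespace AnnularContinuum

variable {K Km Kp Lm Lp : Set Ann}

theorem nonempty_homeomorph_union {h : Ann → Ann} (hh : IsOpenEmbedding h)
    (hL : AnnularContinuum (h '' stdA) Lm Lp) (hK : AnnularContinuum K Km Kp)
    (hlow : ∀ p : Ann, p.2 < 0 → h p ∈ Lm) (hhigh : ∀ p : Ann, 1 < p.2 → h p ∈ Lp) :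
    Nonempty (↥(Lm ∪ h '' Km) ≃ₜ halfOpenAnn) := by
  obtain ⟨U, hU, hKm⟩ := hK.exists_isOpen
  obtain ⟨φ⟩ := hK.2.2.2.2.2.2.1
  obtain ⟨ψ⟩ := hL.2.2.2.2.2.2.1
  obtain ⟨θ⟩ := nonempty_homeomorph_union_image hh hU hKm (fun p hp ↦ hK.snd_lt_one hp)
    hK.2.2.2.2.1 φ hlow (fun p hp hpL ↦ by
      by_cases hp1 : p.2 ≤ 1
      · exact (hL.subset_diff_left hpL).2 (mem_image_of_mem h ⟨hp, hp1⟩)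
      · exact disjoint_left.1 hL.disjoint hpL (hhigh p (not_le.1 hp1)))
  exact ⟨θ.trans ψ⟩

theorem image_of_sides {h : Ann → Ann} (hh : IsOpenEmbedding h) (hr : range h ⊆ stdA)
    (hL : AnnularContinuum (h '' stdA) Lm Lp) (hK : AnnularContinuum K Km Kp)
    (hlow : ∀ p : Ann, p.2 < 0 → h p ∈ Lm) (hhigh : ∀ p : Ann, 1 < p.2 → h p ∈ Lp) :
    AnnularContinuum (h '' K) (Lm ∪ h '' Km) (Lp ∪ h '' Kp) := by
  have hLm : Disjoint (h '' stdA) Lm :=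
    disjoint_right.2 fun x hx ↦ (hL.subset_diff_left hx).2
  have hLp : Disjoint (h '' stdA) Lp :=
    disjoint_right.2 fun x hx ↦ (hL.subset_diff_right hx).2
  have hdm : Disjoint (h '' {p | 0 < p.2}) Lm := by
    rw [disjoint_left]
    rintro _ ⟨p, hp, rfl⟩ hpL
    have hp : 0 < p.2 := hp
    by_cases hp1 : p.2 ≤ 1
    · exact disjoint_right.1 hLm hpL (mem_image_of_mem h ⟨hp.le, hp1⟩)
    · exact disjoint_left.1 hL.disjoint hpL (hhigh p (not_le.1 hp1))
  have hdp : Disjoint (h '' {p | p.2 < 1}) Lp := by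
    rw [disjoint_left]
    rintro _ ⟨p, hp, rfl⟩ hpL
    have hp : p.2 < 1 := hp
    by_cases hp0 : 0 ≤ p.2
    · exact disjoint_right.1 hLp hpL (mem_image_of_mem h ⟨hp0, hp.le⟩)
    · exact disjoint_right.1 hL.disjoint hpL (hlow p (not_le.1 hp0))
  refine ⟨hK.1.image hh.continuous, hK.2.1.image h hh.continuous.continuousOn,
    (image_subset_range _ _).trans hr, ?_, hL.2.2.2.2.1.trans subset_union_left,
    hL.2.2.2.2.2.1.trans subset_union_left, nonempty_homeomorph_union hh hL hK hlow hhigh, ?_⟩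
  · refine TwoComponents.of_separated (hL.two.nonempty_left.mono subset_union_left)
      (hL.two.symm.nonempty_left.mono subset_union_left) ?_ ?_ ?_ ?_ ?_
    · refine isPreconnected_union_image (O := {p | p.2 ∈ Iio (0 : ℝ)}) (p := (0, 0)) hh.continuous
        hL.two.isPreconnected_left hK.two.isPreconnected_left hlow (hK.2.2.2.2.1 rfl)
        (mem_closure_snd_preimage ?_)
      simp
    · refine isPreconnected_union_image (O := {p | p.2 ∈ Ioi (1 : ℝ)}) (p := (0, 1)) hh.continuous
        hL.two.symm.isPreconnected_left hK.two.symm.isPreconnected_left hhigh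
        (hK.2.2.2.2.2.1 rfl) (mem_closure_snd_preimage ?_)
      simp
    · have hunion : stdA \ h '' K = (stdA \ h '' stdA) ∪ h '' (stdA \ K) := by
        rw [image_sdiff hh.injective, sdiff_union_sdiff_cancel ((image_subset_range _ _).trans hr)
          (image_mono hK.2.2.1)]
      rw [hunion, ← hL.two.2.1, ← hK.two.2.1, image_union, union_union_union_comm]
    · exact disjoint_closure_union_image hh hL.two.disjoint_closure_left
        hK.two.disjoint_closure_left (fun p hp ↦ (hK.subset_diff_left hp).1) hLp
        (isOpen_lt continuous_const continuous_snd) (fun p hp ↦ hK.snd_pos hp) hdm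
    · exact (disjoint_closure_union_image hh hL.two.symm.disjoint_closure_left
        hK.two.symm.disjoint_closure_left (fun p hp ↦ (hK.subset_diff_right hp).1) hLm
        (isOpen_lt continuous_snd continuous_const) (fun p hp ↦ hK.snd_lt_one hp) hdp).symm
  · have hcomp : ∀ X : Set Ann, (flipAnn ∘ h ∘ flipAnn) '' (flipAnn '' X) =
        flipAnn '' (h '' X) := by
      intro X
      simp only [image_image, Function.comp, flipAnn_flipAnn]
    have hL' := hL.flip
    rw [← hcomp, flipAnn_image_stdA] at hL'
    obtain ⟨θ⟩ := nonempty_homeomorph_union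
      (flipAnn.isOpenEmbedding.comp (hh.comp flipAnn.isOpenEmbedding)) hL' hK.flip
      (fun p hp ↦ mem_image_of_mem flipAnn (hhigh _ (by rw [flipAnn_apply]; dsimp only; linarith)))
      (fun p hp ↦ mem_image_of_mem flipAnn (hlow _ (by simp [flipAnn_apply, hp])))
    rw [hcomp, ← image_union] at θ
    exact ⟨(flipAnn.image _).trans θ⟩

/-- The components of the complement of an embedded annulus each contain exactly one of the
two outer collars. -/
theorem sides {h : Ann → Ann} (hh : IsOpenEmbedding h) (hr : range h ⊆ stdA)
    (hL : AnnularContinuum (h '' stdA) Lm Lp) :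
    ((∀ p : Ann, p.2 < 0 → h p ∈ Lm) ∧ ∀ p : Ann, 1 < p.2 → h p ∈ Lp) ∨
      ((∀ p : Ann, p.2 < 0 → h p ∈ Lp) ∧ ∀ p : Ann, 1 < p.2 → h p ∈ Lm) := by
  have hside : ∀ {A B : Set Ann}, TwoComponents (stdA \ h '' stdA) A B →
      (∀ p : Ann, p.2 < 0 → h p ∈ A) → ¬ ∀ p : Ann, 1 < p.2 → h p ∈ A := by
    intro A B hAB h1 h2
    have hmem : ∀ x ∈ stdA, x ∈ A ∨ x ∈ B ∨ x ∈ h '' stdA := by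
      intro x hx
      by_cases hx' : x ∈ h '' stdA
      · exact Or.inr (Or.inr hx')
      · have : x ∈ A ∪ B := by
          rw [hAB.2.1]
          exact ⟨hx, hx'⟩
        exact this.imp id Or.inl
    have hBW : B ⊆ stdA \ h '' stdA := hAB.2.1 ▸ subset_union_right
    have hAW : A ⊆ stdA \ h '' stdA := hAB.2.1 ▸ subset_union_left
    have hA : ∀ x ∈ A, x ∉ closure B := fun x hx ↦
      disjoint_right.1 hAB.symm.disjoint_closure_left hx
    have hB : ∀ x ∈ B, x ∉ closure A := fun x hx ↦ disjoint_right.1 hAB.disjoint_closure_left hx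
    obtain ⟨a, ha⟩ := hAB.nonempty_left
    obtain ⟨b, hb⟩ := hAB.symm.nonempty_left
    obtain ⟨y, hy, hyU, hyA, hyh⟩ := isPreconnected_snd_preimage (I := Icc 0 1) isPreconnected_Icc
      (range h ∪ (closure B)ᶜ) ((closure A)ᶜ ∩ (h '' stdA)ᶜ)
      (hh.isOpen_range.union isClosed_closure.isOpen_compl)
      (isClosed_closure.isOpen_compl.inter
        (isCompact_stdA.image hh.continuous).isClosed.isOpen_compl)
      (fun x hx ↦ by
        rcases hmem x hx with h' | h' | h'
        · exact Or.inl (Or.inr (hA x h'))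
        · exact Or.inr ⟨hB x h', (hBW h').2⟩
        · exact Or.inl (Or.inl (image_subset_range _ _ h')))
      ⟨a, (hAW ha).1, Or.inr (hA a ha)⟩ ⟨b, (hBW hb).1, hB b hb, (hBW hb).2⟩
    have hyA' : y ∉ A := fun h' ↦ hyA (subset_closure h')
    rcases hyU with ⟨p, rfl⟩ | hyB
    · rcases lt_or_ge p.2 0 with hp | hp
      · exact hyA' (h1 p hp)
      · rcases lt_or_ge 1 p.2 with hp' | hp'
        · exact hyA' (h2 p hp')
        · exact hyh (mem_image_of_mem h ⟨hp, hp'⟩)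
    · exact hyB (subset_closure (((hmem y hy).resolve_left hyA').resolve_right hyh))
  have hcollar : ∀ I : Set ℝ, IsPreconnected I → I.Nonempty → Disjoint I (Icc 0 1) →
      (∀ p : Ann, p.2 ∈ I → h p ∈ Lm) ∨ ∀ p : Ann, p.2 ∈ I → h p ∈ Lp := by
    rintro I hI ⟨t, ht⟩ hdisj
    have := hL.two.subset_or_subset
      ((isPreconnected_snd_preimage hI).image h hh.continuous.continuousOn)
      ⟨h (0, t), mem_image_of_mem h ht⟩ (by
        rintro _ ⟨p, hp, rfl⟩
        refine ⟨hr (mem_range_self p), ?_⟩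
        rintro ⟨q, hq, hqp⟩
        rw [hh.injective hqp] at hq
        exact disjoint_left.1 hdisj hp hq)
    exact this.imp (fun h' p hp ↦ h' (mem_image_of_mem h hp))
      fun h' p hp ↦ h' (mem_image_of_mem h hp)
  have h0 := hcollar (Iio 0) isPreconnected_Iio nonempty_Iio
    (disjoint_left.2 fun t ht ht' ↦ not_lt.2 ht'.1 ht)
  have h1 := hcollar (Ioi 1) isPreconnected_Ioi nonempty_Ioi
    (disjoint_left.2 fun t ht ht' ↦ not_lt.2 ht'.2 ht)
  rcases h0 with h0 | h0
  · exact Or.inl ⟨h0, h1.resolve_left (hside hL.two h0)⟩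
  · exact Or.inr ⟨h0, h1.resolve_right (hside hL.two.symm h0)⟩

theorem image {h : Ann → Ann} (hh : IsOpenEmbedding h) (hr : range h ⊆ stdA)
    (hL : AnnularContinuum (h '' stdA) Lm Lp) (hK : AnnularContinuum K Km Kp) :
    ∃ Km' Kp', AnnularContinuum (h '' K) Km' Kp' := by
  rcases hL.sides hh hr with ⟨h0, h1⟩ | ⟨h0, h1⟩
  · exact ⟨_, _, image_of_sides hh hr hL hK h0 h1⟩
  · have hcomp : ∀ X : Set Ann, (h ∘ flipAnn) '' (flipAnn '' X) = h '' X := by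
      intro X
      simp only [image_image, Function.comp, flipAnn_flipAnn]
    rw [← hcomp, flipAnn_image_stdA] at hL
    rw [← hcomp]
    exact ⟨_, _, image_of_sides (hh.comp flipAnn.isOpenEmbedding)
      ((range_comp_subset_range _ _).trans hr) hL hK.flip
      (fun p hp ↦ h1 _ (by rw [flipAnn_apply]; dsimp only; linarith))
      fun p hp ↦ h0 _ (by simp [flipAnn_apply, hp])⟩

end AnnularContinuum

theorem exists_isOpenEmbedding_real {ε : ℝ} (hε : 0 < ε) :
    ∃ ρ : ℝ → ℝ, IsOpenEmbedding ρ ∧ EqOn ρ id (Icc 0 1) ∧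
      range ρ ⊆ Metric.thickening ε (Icc 0 1) := by
  set c : ℝ → ℝ := fun t ↦ max 0 (min 1 t) with hc
  have habs : ∀ u : ℝ, 0 < 1 + |u| := fun u ↦ by positivity
  set ρ : ℝ → ℝ := fun t ↦ c t + ε * ((t - c t) / (1 + |t - c t|)) with hρ
  have hcont : Continuous ρ := by
    have : ∀ t : ℝ, 1 + |t - c t| ≠ 0 := fun t ↦ (habs _).ne'
    fun_prop (disch := assumption)
  have hs : StrictMono fun u : ℝ ↦ u / (1 + |u|) := by
    intro u v huv
    have hu := habs u
    have hv := habs v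
    simp only
    rw [div_lt_div_iff₀ hu hv]
    rcases abs_cases u with ⟨h1, h2⟩ | ⟨h1, h2⟩ <;> rcases abs_cases v with ⟨h3, h4⟩ | ⟨h3, h4⟩ <;>
      rw [h1, h3] <;> nlinarith
  have hcm : Monotone c := fun s t hst ↦ max_le_max le_rfl (min_le_min le_rfl hst)
  have hdm : Monotone fun t ↦ t - c t := by
    intro s t hst
    simp only [hc]
    rcases max_cases 0 (min 1 s) with ⟨h1, h2⟩ | ⟨h1, h2⟩ <;>
      rcases min_cases 1 s with ⟨h3, h4⟩ | ⟨h3, h4⟩ <;>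
      rcases max_cases 0 (min 1 t) with ⟨h5, h6⟩ | ⟨h5, h6⟩ <;>
      rcases min_cases 1 t with ⟨h7, h8⟩ | ⟨h7, h8⟩ <;> linarith
  have hmono : StrictMono ρ := by
    intro s t hst
    have h1 := hcm hst.le
    have h2 := hdm hst.le
    rcases h2.lt_or_eq with h | h
    · have := mul_lt_mul_of_pos_left (hs h) hε
      simp only [hρ] at this ⊢
      linarith
    · simp only at h
      simp only [hρ, h]
      linarith
  have hopen : IsOpen (range ρ) := by
    have : range ρ = ⋃ n : ℕ, Ioo (ρ (-n)) (ρ n) := by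
      ext y
      simp only [mem_range, mem_iUnion]
      constructor
      · rintro ⟨t, rfl⟩
        obtain ⟨n, hn⟩ := exists_nat_gt |t|
        exact ⟨n, hmono (abs_lt.1 hn).1, hmono (abs_lt.1 hn).2⟩
      · rintro ⟨n, hn⟩
        obtain ⟨t, -, ht⟩ := intermediate_value_Icc (by simp) hcont.continuousOn
          (Ioo_subset_Icc_self hn)
        exact ⟨t, ht⟩
    rw [this]
    exact isOpen_iUnion fun n ↦ isOpen_Ioo
  refine ⟨ρ, ⟨hmono.isEmbedding_of_ordConnected (isPreconnected_range hcont).ordConnected, hopen⟩,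
    fun t ht ↦ ?_, ?_⟩
  · have : c t = t := by simp [hc, ht.1, ht.2]
    simp [hρ, this]
  · rintro _ ⟨t, rfl⟩
    refine Metric.mem_thickening_iff.2 ⟨c t,
      ⟨le_max_left _ _, max_le zero_le_one (min_le_left _ _)⟩, ?_⟩
    rw [Real.dist_eq]
    simp only [hρ, add_sub_cancel_left, abs_mul, abs_div, abs_of_pos hε, abs_of_pos (habs _)]
    have : |t - c t| / (1 + |t - c t|) < 1 := by
      rw [div_lt_one (habs _)]
      linarith
    nlinarith

/-- An open embedding of the annulus can be modified off `stdA` so that its range lies in any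
given neighbourhood of the image of `stdA`. -/
theorem exists_isOpenEmbedding_range_subset {S : Type*} [TopologicalSpace S] {e : Ann → S}
    (he : IsOpenEmbedding e) {U : Set S} (hU : IsOpen U) (heU : e '' stdA ⊆ U) :
    ∃ e' : Ann → S, IsOpenEmbedding e' ∧ EqOn e' e stdA ∧ range e' ⊆ U := by
  obtain ⟨V, W, -, hW, hV, hIW, hVW⟩ := generalized_tube_lemma (isCompact_univ (X := Circ))
    (isCompact_Icc (a := (0 : ℝ)) (b := 1)) (hU.preimage he.continuous)
    (fun p hp ↦ heU (mem_image_of_mem e hp.2))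
  obtain ⟨ε, hε, hεW⟩ := isCompact_Icc.exists_thickening_subset_open hW hIW
  obtain ⟨ρ, hρ, hρ1, hρr⟩ := exists_isOpenEmbedding_real hε
  refine ⟨e ∘ Prod.map id ρ, he.comp (IsOpenEmbedding.id.prodMap hρ), fun p hp ↦ ?_, ?_⟩
  · simp [Prod.map, hρ1 hp]
  · rintro _ ⟨p, rfl⟩
    exact hVW ⟨hV (mem_univ _), hεW (hρr (mem_range_self _))⟩

theorem AnnularContinuum.subset_interior {K Km Kp : Set Ann} (hK : AnnularContinuum K Km Kp) :
    K ⊆ {p | p.2 ∈ Ioo (0 : ℝ) 1} := by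
  intro p hp
  have h := hK.2.2.1 hp
  refine ⟨lt_of_le_of_ne h.1 fun h0 ↦ ?_, lt_of_le_of_ne h.2 fun h1 ↦ ?_⟩
  · exact (hK.subset_diff_left (hK.2.2.2.2.1 h0.symm)).2 hp
  · exact (hK.subset_diff_right (hK.2.2.2.2.2.1 h1)).2 hp

theorem EssentialIn.trans {S : Type*} [TopologicalSpace S] {K E E' : Set S}
    (hK : EssentialIn K E) (hE : EssentialIn E E') : EssentialIn K E' := by
  obtain ⟨e, he, rfl, K₀, Km, Kp, hK₀, rfl⟩ := hK
  obtain ⟨e', he', rfl, L₀, Lm, Lp, hL₀, hL⟩ := hE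
  obtain ⟨f, hf, hfe, hfr⟩ := exists_isOpenEmbedding_range_subset he
    (he'.isOpenMap {p | p.2 ∈ Ioo (0 : ℝ) 1} (isOpen_Ioo.preimage continuous_snd))
    (hL.trans_subset (image_mono hL₀.subset_interior))
  choose h hh hf' using fun p ↦ hfr (mem_range_self p)
  have hcomp : e' ∘ h = f := funext hf'
  have hh' : IsOpenEmbedding h := IsOpenEmbedding.of_comp h he' (hcomp ▸ hf)
  have himage : ∀ X ⊆ stdA, e' '' (h '' X) = e '' X := fun X hX ↦ by
    rw [← image_comp, hcomp]
    exact (hfe.mono hX).image_eq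
  have hstd : h '' stdA = L₀ := he'.injective.image_injective ((himage _ Subset.rfl).trans hL)
  obtain ⟨Km', Kp', hK'⟩ := AnnularContinuum.image hh'
    (range_subset_iff.2 fun p ↦ Ioo_subset_Icc_self (hh p)) (hstd ▸ hL₀) hK₀
  exact ⟨e', he', rfl, h '' K₀, Km', Kp', hK', (himage _ hK₀.2.2.1).symm⟩

/-- Let `S` be a compact surface and `𝒜` a countable family of closed annuli
in `S` such that every closed annulus of `S` is essentially contained in the interior of
some member of `𝒜`. If `K` is an essential annular continuum in some closed annulus `E`,
then there is `E' ∈ 𝒜` with `K ⊆ int E'` and `K` essential in `E'`. -/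
theorem exists_annulus_in_family_essential
    {S : Type*} [TopologicalSpace S] [CompactSpace S] [T2Space S]
    [ChartedSpace (ℝ × ℝ) S]
    (𝒜 : Set (Set S)) (hcount : 𝒜.Countable)
    (hfam : ∀ E : Set S, IsClosedAnnulusIn E →
      ∃ E' ∈ 𝒜, IsClosedAnnulusIn E' ∧ E ⊆ interior E' ∧ EssentialIn E E')
    (E K : Set S) (hE : IsClosedAnnulusIn E) (hKE : K ⊆ E)
    (hK : EssentialIn K E) :
    ∃ E' ∈ 𝒜, K ⊆ interior E' ∧ EssentialIn K E' := by
  obtain ⟨E', hE', -, hsub, hess⟩ := hfam E hE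
  exact ⟨E', hE', hKE.trans hsub, hK.trans hess⟩
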